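/- arXiv:1812.09526 — 5 statements merged into one kernel-verified Lean document; each statement's English description precedes it below -/
import Mathlib

section
/- Modularization Lemma (variant): Let H=(V,E) be a hypergraph in which every vertex belongs to at least one edge, and let B ⊆ V. Then sup{ h(B) : h is an edge-dominated E-polymatroid on V } = sup{ h(B) : h is a nonnegative edge-dominated modular set function on V }, and both suprema are attained. -/
/-- An `E`-polymatroid on a finite set `V`: nonnegative, zero on `∅`, monotone, and submodular
on all pairs `X, Y` whose intersection is contained in some edge of `E`. -/
def IsEPolymatroid {V : Type} [Fintype V] [DecidableEq V]
    (E : Finset (Finset V)) (h : Finset V → ℝ) : Prop :=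
  (∀ S : Finset V, 0 ≤ h S) ∧ h ∅ = 0 ∧
    (∀ X Y : Finset V, X ⊆ Y → h X ≤ h Y) ∧
    (∀ X Y : Finset V, (∃ S ∈ E, X ∩ Y ⊆ S) → h (X ∪ Y) + h (X ∩ Y) ≤ h X + h Y)

/-- Edge-dominated: at most `1` on every edge. -/
def EdgeDominated {V : Type} [Fintype V] [DecidableEq V]
    (E : Finset (Finset V)) (h : Finset V → ℝ) : Prop :=
  ∀ S ∈ E, h S ≤ 1

/-- Modular set function. -/
def IsModular {V : Type} [Fintype V] [DecidableEq V] (h : Finset V → ℝ) : Prop :=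
  ∀ S : Finset V, h S = ∑ v ∈ S, h {v}

/-- A nonnegative modular set function is an `E`-polymatroid for every `E`. -/
theorem isEPolymatroid_sum {V : Type} [Fintype V] [DecidableEq V]
    (E : Finset (Finset V)) {w : V → ℝ} (hw : ∀ v, 0 ≤ w v) :
    IsEPolymatroid E (fun S => ∑ v ∈ S, w v) :=
  ⟨fun _ => Finset.sum_nonneg fun v _ => hw v, Finset.sum_empty,
    fun _ _ hXY => Finset.sum_le_sum_of_subset_of_nonneg hXY fun v _ _ => hw v,
    fun _ _ _ => Finset.sum_union_inter.le⟩

theorem isModular_sum {V : Type} [Fintype V] [DecidableEq V] (w : V → ℝ) :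
    IsModular (fun S : Finset V => ∑ v ∈ S, w v) := by
  intro S
  simp

/-- The greedy weights of an `E`-polymatroid along an enumeration of `B`: they sum to `h B` on `B`,
and on each edge `S` they sum to at most `h (S ∩ B)`. -/
theorem IsEPolymatroid.exists_weight {V : Type} [Fintype V] [DecidableEq V]
    {E : Finset (Finset V)} {h : Finset V → ℝ} (hh : IsEPolymatroid E h) (B : Finset V) :
    ∃ w : V → ℝ, (∀ v, 0 ≤ w v) ∧ (∀ v ∉ B, w v = 0) ∧ ∑ v ∈ B, w v = h B ∧
      ∀ S ∈ E, ∑ v ∈ S, w v ≤ h (S ∩ B) := by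
  obtain ⟨-, hempty, hmono, hsub⟩ := hh
  induction B using Finset.induction_on with
  | empty => exact ⟨0, by simp [hempty]⟩
  | insert a B ha ih =>
    obtain ⟨w, hw, hw0, hwB, hwE⟩ := ih
    have hc : h B ≤ h (insert a B) := hmono _ _ (Finset.subset_insert a B)
    refine ⟨fun v => w v + if a = v then h (insert a B) - h B else 0, fun v => ?_,
      fun v hv => ?_, ?_, fun S hS => ?_⟩
    · have := hw v
      dsimp only
      split_ifs <;> linarith
    · rw [Finset.mem_insert, not_or] at hv
      simp [hw0 v hv.2, Ne.symm hv.1]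
    · rw [Finset.sum_add_distrib, Finset.sum_ite_eq, Finset.sum_insert ha, hw0 a ha, hwB]
      simp
    · rw [Finset.sum_add_distrib, Finset.sum_ite_eq]
      have hSB := hwE S hS
      by_cases haS : a ∈ S
      · have hunion : S ∩ insert a B ∪ B = insert a B := by
          ext v
          simp only [Finset.mem_union, Finset.mem_inter, Finset.mem_insert]
          grind
        have hinter : S ∩ insert a B ∩ B = S ∩ B := by
          ext v
          simp only [Finset.mem_inter, Finset.mem_insert]
          tauto
        have := hsub (S ∩ insert a B) B ⟨S, hS, hinter ▸ Finset.inter_subset_left⟩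
        rw [hunion, hinter] at this
        rw [if_pos haS]
        linarith
      · rw [if_neg haS, Finset.inter_insert_of_notMem haS]
        linarith

/-- Fractional vertex packings of a hypergraph without isolated vertices attain a maximal weight
on every vertex set `B`. -/
theorem exists_max_weight {V : Type} [Fintype V] [DecidableEq V] (E : Finset (Finset V))
    (hcov : ∀ v : V, ∃ S ∈ E, v ∈ S) (B : Finset V) :
    ∃ w : V → ℝ, (∀ v, 0 ≤ w v) ∧ (∀ S ∈ E, ∑ v ∈ S, w v ≤ 1) ∧
      ∀ u : V → ℝ, (∀ v, 0 ≤ u v) → (∀ S ∈ E, ∑ v ∈ S, u v ≤ 1) →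
        ∑ v ∈ B, u v ≤ ∑ v ∈ B, w v := by
  let K : Set (V → ℝ) := {w | (∀ v, 0 ≤ w v) ∧ ∀ S ∈ E, ∑ v ∈ S, w v ≤ 1}
  have hclosed : IsClosed K := by
    simp only [K, Set.ofPred_and, Set.ofPred_forall]
    refine (isClosed_iInter fun v => isClosed_le (by fun_prop) (by fun_prop)).inter
      (isClosed_iInter fun S => isClosed_iInter fun _ => isClosed_le (by fun_prop) (by fun_prop))
  have hsubset : K ⊆ Set.Icc 0 1 := by
    rintro w ⟨hw, hwE⟩
    refine ⟨hw, fun v => ?_⟩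
    obtain ⟨S, hS, hvS⟩ := hcov v
    exact (Finset.single_le_sum (fun u _ => hw u) hvS).trans (hwE S hS)
  have hK : IsCompact K := isCompact_Icc.of_isClosed_subset hclosed hsubset
  obtain ⟨w, hw, hmax⟩ := hK.exists_isMaxOn ⟨0, by simp [K]⟩
    (f := fun w : V → ℝ => ∑ v ∈ B, w v) (by fun_prop)
  exact ⟨w, hw.1, hw.2, fun u hu huE => hmax ⟨hu, huE⟩⟩

/-- Modularization Lemma (variant): the supremum of `h(B)` over edge-dominated
`E`-polymatroids equals the supremum over nonnegative edge-dominated modular set functions,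
and both suprema are attained. -/
theorem modularization_lemma
    (V : Type) [Fintype V] [DecidableEq V] (E : Finset (Finset V))
    (hcov : ∀ v : V, ∃ S ∈ E, v ∈ S) (B : Finset V) :
    ∃ hstar gstar : Finset V → ℝ,
      IsEPolymatroid E hstar ∧ EdgeDominated E hstar ∧
      (∀ S : Finset V, 0 ≤ gstar S) ∧ IsModular gstar ∧ EdgeDominated E gstar ∧
      gstar B = hstar B ∧
      (∀ h : Finset V → ℝ, IsEPolymatroid E h → EdgeDominated E h → h B ≤ hstar B) ∧
      (∀ g : Finset V → ℝ, (∀ S : Finset V, 0 ≤ g S) → IsModular g →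
        EdgeDominated E g → g B ≤ gstar B) := by
  obtain ⟨w, hw, hwE, hmax⟩ := exists_max_weight E hcov B
  have hpoly := isEPolymatroid_sum E hw
  refine ⟨fun S => ∑ v ∈ S, w v, fun S => ∑ v ∈ S, w v, hpoly, hwE, hpoly.1, isModular_sum w,
    hwE, rfl, fun h hh hdom => ?_, fun g hg hmod hdom => ?_⟩
  · obtain ⟨u, hu, -, huB, huE⟩ := hh.exists_weight B
    rw [← huB]
    exact hmax u hu fun S hS =>
      (huE S hS).trans ((hh.2.2.1 _ _ Finset.inter_subset_left).trans (hdom S hS))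
  · rw [hmod B]
    exact hmax (fun v => g {v}) (fun v => hg {v}) fun S hS => (hmod S).symm.trans_le (hdom S hS)
end

section
/- Let n ≥ 1, let E be a collection of subsets of [n] = {1,…,n}, and let h* be an E-polymatroid on [n]. Define h̄ : 2^[n] → ℝ by h̄(F) = Σ_{i∈F} ( h*([i]) − h*([i−1]) ), where [i] = {1,…,i} and [0] = ∅. Then: (1) h̄ is a nonnegative modular set function; (2) h̄([k]) = h*([k]) for every 0 ≤ k ≤ n; and (3) h̄(F) ≤ h*(F) for every F ⊆ [n] such that F ⊆ E0 for some E0 ∈ E. -/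
/-- The prefix `[k] = {1, …, k}` of `[n]`, encoded as the elements of `Fin n` whose
(0-based) index is `< k`. -/
def prefixSet (n k : ℕ) : Finset (Fin n) :=
  Finset.univ.filter (fun j : Fin n => (j : ℕ) < k)

theorem prefixSet_mono (n : ℕ) {k l : ℕ} (hkl : k ≤ l) : prefixSet n k ⊆ prefixSet n l := by
  intro j hj
  simp only [prefixSet, Finset.mem_filter, Finset.mem_univ, true_and] at hj ⊢
  omega

theorem prefixSet_zero (n : ℕ) : prefixSet n 0 = ∅ := by
  simp [prefixSet]

theorem prefixSet_succ {n : ℕ} (a : Fin n) :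
    prefixSet n ((a : ℕ) + 1) = insert a (prefixSet n a) := by
  ext j
  simp only [prefixSet, Finset.mem_filter, Finset.mem_univ, true_and, Finset.mem_insert,
    Fin.ext_iff]
  omega

theorem notMem_prefixSet_self {n : ℕ} (a : Fin n) : a ∉ prefixSet n a := by
  simp [prefixSet]

/-- Telescoping of increments along the prefixes. -/
theorem sum_prefixSet_increments {n : ℕ} (h : Finset (Fin n) → ℝ) (h0 : h ∅ = 0) {k : ℕ}
    (hk : k ≤ n) :
    ∑ i ∈ prefixSet n k, (h (prefixSet n ((i : ℕ) + 1)) - h (prefixSet n (i : ℕ))) =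
      h (prefixSet n k) := by
  induction k with
  | zero => simp [prefixSet_zero, h0]
  | succ k ih =>
    have hs := prefixSet_succ (⟨k, hk⟩ : Fin n)
    have hn := notMem_prefixSet_self (⟨k, hk⟩ : Fin n)
    simp only at hs hn
    conv_lhs => rw [hs]
    rw [Finset.sum_insert hn, ih (by omega)]
    simp

/-- On subsets of edges, the sum of prefix increments is at most the polymatroid value. -/
theorem IsEPolymatroid.sum_increments_le {n : ℕ} {E : Finset (Finset (Fin n))}
    {h : Finset (Fin n) → ℝ} (hE : IsEPolymatroid E h) (F : Finset (Fin n))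
    (hF : ∃ S ∈ E, F ⊆ S) :
    ∑ i ∈ F, (h (prefixSet n ((i : ℕ) + 1)) - h (prefixSet n (i : ℕ))) ≤ h F := by
  obtain ⟨-, h0, -, hsub⟩ := hE
  obtain ⟨S, hS, hFS⟩ := hF
  induction F using Finset.induction_on_max with
  | empty => simp [h0]
  | insert a s hlt ih =>
    have ha : a ∉ s := fun hmem => lt_irrefl a (hlt a hmem)
    have hs : s ⊆ prefixSet n a := fun x hx => by simpa [prefixSet] using hlt x hx
    have hsS : s ⊆ S := (Finset.subset_insert a s).trans hFS
    have hinter : insert a s ∩ prefixSet n a = s := by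
      rw [Finset.insert_inter_of_notMem (notMem_prefixSet_self a),
        Finset.inter_eq_left.mpr hs]
    have hunion : insert a s ∪ prefixSet n a = prefixSet n ((a : ℕ) + 1) := by
      rw [Finset.insert_union, Finset.union_eq_right.mpr hs, prefixSet_succ]
    have key := hsub (insert a s) (prefixSet n a) ⟨S, hS, hinter.le.trans hsS⟩
    rw [hinter, hunion] at key
    rw [Finset.sum_insert ha]
    linarith [ih hsS]

/-- The modular function `h̄(F) = Σ_{i∈F} (h*([i]) − h*([i−1]))` built from an `E`-polymatroid
`h*` is nonnegative, modular, agrees with `h*` on all prefixes `[k]`, and is dominated by `h*`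
on every set contained in an edge of `E`. -/
theorem modularization_construction
    (n : ℕ) (hn : 1 ≤ n) (E : Finset (Finset (Fin n)))
    (hstar : Finset (Fin n) → ℝ) (hEP : IsEPolymatroid E hstar)
    (hbar : Finset (Fin n) → ℝ)
    (hdef : ∀ F : Finset (Fin n),
      hbar F = ∑ i ∈ F, (hstar (prefixSet n ((i : ℕ) + 1)) - hstar (prefixSet n (i : ℕ)))) :
    (∀ F : Finset (Fin n), 0 ≤ hbar F) ∧
    IsModular hbar ∧
    (∀ k : ℕ, k ≤ n → hbar (prefixSet n k) = hstar (prefixSet n k)) ∧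
    (∀ F : Finset (Fin n), (∃ E0 ∈ E, F ⊆ E0) → hbar F ≤ hstar F) := by
  refine ⟨fun F => ?_, fun F => ?_, fun k hk => ?_, fun F hF => ?_⟩
  · rw [hdef]
    exact Finset.sum_nonneg fun i _ =>
      sub_nonneg.mpr (hEP.2.2.1 _ _ (prefixSet_mono n (Nat.le_succ _)))
  · simp [hdef]
  · rw [hdef]
    exact sum_prefixSet_increments hstar hEP.2.1 hk
  · rw [hdef]
    exact hEP.sum_increments_le F hF
end

section
/- Let H=(V,E) be a hypergraph and B ⊆ V a nonempty set such that every vertex of B belongs to at least one edge of E. Then every edge-dominated E-polymatroid h on V satisfies h(B) ≤ ρ*_E(B), the fractional edge cover number of B. (This is the key inequality behind the chain smfw(Q) ≤ #smfw(Q) ≤ faqw(Q): applied bag-by-bag it yields that the #-submodular FAQ-width is at most the FAQ-width, and in particular #subw(Q) ≤ fhtw(Q) for queries without free variables.) -/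
/-- The set of values of feasible fractional edge covers of `B` using the edges `E`;
its infimum is the fractional edge cover number `ρ*_E(B)`. -/
def fracEdgeCoverValues {V : Type} [Fintype V] [DecidableEq V]
    (E : Finset (Finset V)) (B : Finset V) : Set ℝ :=
  { r : ℝ | ∃ y : Finset V → ℝ, (∀ S : Finset V, 0 ≤ y S) ∧
      (∀ v ∈ B, 1 ≤ ∑ S ∈ E.filter (fun S => v ∈ S), y S) ∧
      r = ∑ S ∈ E, y S }

/-- An `E`-polymatroid is bounded on `B` by any fractional cover of `B` weighted by the traces
of the edges on `B`. -/
theorem IsEPolymatroid.le_sum_mul_inter {V : Type} [Fintype V] [DecidableEq V]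
    {E : Finset (Finset V)} {h : Finset V → ℝ} (hEP : IsEPolymatroid E h)
    {y : Finset V → ℝ} (hy : ∀ S, 0 ≤ y S) (B : Finset V)
    (hB : ∀ v ∈ B, 1 ≤ ∑ S ∈ E.filter (fun S => v ∈ S), y S) :
    h B ≤ ∑ S ∈ E, y S * h (S ∩ B) := by
  obtain ⟨-, h0, hmono, hsub⟩ := hEP
  induction B using Finset.induction_on with
  | empty => simp [h0]
  | insert v P hv ih =>
    have ihP := ih fun w hw => hB w (Finset.mem_insert_of_mem hw)
    have hd : 0 ≤ h (insert v P) - h P := sub_nonneg.2 (hmono _ _ (Finset.subset_insert v P))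
    have marginal : ∀ S ∈ E, (if v ∈ S then y S else 0) * (h (insert v P) - h P) ≤
        y S * h (S ∩ insert v P) - y S * h (S ∩ P) := by
      intro S hS
      by_cases hvS : v ∈ S
      · have hinter : (S ∩ insert v P) ∩ P = S ∩ P := by grind
        have hunion : (S ∩ insert v P) ∪ P = insert v P := by grind
        have key := hsub (S ∩ insert v P) P ⟨S, hS, hinter ▸ Finset.inter_subset_left⟩
        rw [hinter, hunion] at key
        rw [if_pos hvS, ← mul_sub]
        exact mul_le_mul_of_nonneg_left (by linarith) (hy S)
      · rw [Finset.inter_insert_of_notMem hvS]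
        simp [hvS]
    have hsum := Finset.sum_le_sum marginal
    rw [← Finset.sum_mul, ← Finset.sum_filter, Finset.sum_sub_distrib] at hsum
    have hone := le_mul_of_one_le_left hd (hB v (Finset.mem_insert_self v P))
    linarith

/-- Every edge-dominated `E`-polymatroid satisfies `h(B) ≤ ρ*_E(B)`. -/
theorem epolymatroid_le_fractional_edge_cover
    (V : Type) [Fintype V] [DecidableEq V] (E : Finset (Finset V))
    (B : Finset V) (hBne : B.Nonempty) (hcov : ∀ v ∈ B, ∃ S ∈ E, v ∈ S)
    (h : Finset V → ℝ) (hEP : IsEPolymatroid E h) (hED : EdgeDominated E h) :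
    h B ≤ sInf (fracEdgeCoverValues E B) := by
  refine le_csInf ?_ ?_
  · refine ⟨_, fun _ => 1, fun _ => zero_le_one, fun v hv => ?_, rfl⟩
    obtain ⟨S, hS, hvS⟩ := hcov v hv
    exact Finset.single_le_sum (f := fun _ : Finset V => (1 : ℝ)) (fun _ _ => zero_le_one)
      (Finset.mem_filter.2 ⟨hS, hvS⟩)
  · rintro r ⟨y, hy, hB, rfl⟩
    refine (hEP.le_sum_mul_inter hy B hB).trans (Finset.sum_le_sum fun S hS => ?_)
    exact mul_le_of_le_one_right (hy S)
      ((hEP.2.2.1 _ _ Finset.inter_subset_left).trans (hED S hS))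
end

section
/- Bag factorization over a commutative semiring: Let D be a commutative semiring, V a finite set, and for each i ∈ V a nonempty set Dom(i); for x ∈ Π_{i∈V} Dom(i) and K ⊆ V write x_K for the restriction of x to K. Let E_s be a finite family of nonempty subsets of V, for each K ∈ E_s let R_K : Π_{i∈K} Dom(i) → D, and let E' ⊆ E_s. Let B be a finite set of 'bags', χ : B → 2^V, and α : E_s → B a map with K ⊆ χ(α(K)) for every K ∈ E_s. For K ∈ E' and b ∈ B with J := K ∩ χ(b) ≠ ∅, define the indicator projection π_{K,b} : Π_{v∈J} Dom(v) → D by π_{K,b}(x_J) = 1 if there exists x_{K∖J} ∈ Π_{v∈K∖J} Dom(v) with R_K((x_J, x_{K∖J})) ≠ 0, and π_{K,b}(x_J) = 0 otherwise. For each b ∈ B define Φ_b(x_{χ(b)}) = ( ∏_{K ∈ α⁻¹(b)} R_K(x_K) ) · ( ∏_{K ∈ E', K∩χ(b) ≠ ∅} π_{K,b}(x_{K∩χ(b)}) ). Then for every x ∈ Π_{i∈V} Dom(i): ∏_{K∈E_s} R_K(x_K) = ∏_{b∈B} Φ_b(x_{χ(b)}). -/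
/-- Bag factorization over a commutative semiring: the product of all input factors equals
the product over the bags of the bag factors `Φ_b`, where `Φ_b` multiplies the factors
assigned to bag `b` by the coverage assignment `α` with the indicator projections onto `b`
of the factors in `E'` whose variables meet the bag. -/
theorem bag_factorization
    {D : Type} [CommSemiring D]
    {V : Type} [DecidableEq V] (Dom : V → Type) (hDom : ∀ i : V, Nonempty (Dom i))
    {ι : Type} [Fintype ι] [DecidableEq ι]
    (edge : ι → Finset V) (hedge : ∀ e : ι, (edge e).Nonempty)
    (R : (e : ι) → ((i : edge e) → Dom i) → D)
    (E' : Finset ι)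
    {τ : Type} [Fintype τ] [DecidableEq τ]
    (χ : τ → Finset V) (α : ι → τ) (hα : ∀ e : ι, edge e ⊆ χ (α e))
    (π : (e : ι) → (b : τ) → ((i : (edge e ∩ χ b : Finset V)) → Dom i) → D)
    (hπ1 : ∀ (e : ι) (b : τ) (xJ : (i : (edge e ∩ χ b : Finset V)) → Dom i),
      (∃ z : (i : edge e) → Dom i,
        (∀ (i : V) (hi : i ∈ edge e ∩ χ b),
          z ⟨i, Finset.mem_of_mem_inter_left hi⟩ = xJ ⟨i, hi⟩) ∧ R e z ≠ 0) →
      π e b xJ = 1)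
    (hπ0 : ∀ (e : ι) (b : τ) (xJ : (i : (edge e ∩ χ b : Finset V)) → Dom i),
      (¬ ∃ z : (i : edge e) → Dom i,
        (∀ (i : V) (hi : i ∈ edge e ∩ χ b),
          z ⟨i, Finset.mem_of_mem_inter_left hi⟩ = xJ ⟨i, hi⟩) ∧ R e z ≠ 0) →
      π e b xJ = 0)
    (x : (i : V) → Dom i) :
    (∏ e : ι, R e (fun i => x i))
      = ∏ b : τ,
          ((∏ e ∈ Finset.univ.filter (fun e : ι => α e = b), R e (fun i => x i)) *
            (∏ e ∈ E'.filter (fun e : ι => (edge e ∩ χ b).Nonempty),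
              π e b (fun i => x i))) := by
  rw [Finset.prod_mul_distrib, Finset.prod_fiberwise]
  by_cases h : ∃ e, R e (fun i => x i) = 0
  · obtain ⟨e, he⟩ := h
    rw [Finset.prod_eq_zero (Finset.mem_univ e) he, zero_mul]
  · push Not at h
    have hproj : ∀ b : τ, ∏ e ∈ E'.filter (fun e : ι => (edge e ∩ χ b).Nonempty),
        π e b (fun i => x i) = 1 := fun b =>
      Finset.prod_eq_one fun e _ =>
        hπ1 e b _ ⟨fun i => x i, fun _ _ => rfl, h e⟩
    simp only [hproj, Finset.prod_const_one, mul_one]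
end

section
/- Let V = {a,b,c,d} and E = {{a,b}, {b,c}, {c,d}}, and let h be an edge-dominated E-polymatroid on V (so h({a,b}) ≤ 1, h({b,c}) ≤ 1, h({c,d}) ≤ 1). Then: (1) if h({b}) ≥ 1/2 then h({a,b,c}) ≤ 3/2; (2) if h({b}) ≤ 1/2 then h({b,c,d}) ≤ 3/2. Consequently min( max(h({a,b,c}), h({c,d})), max(h({a,b}), h({b,c,d})) ) ≤ 3/2, which shows that the relaxed #-submodular FAQ-width of the 4-path query R(a,b) ∧ S(b,c) ∧ T(c,d) with one additive inequality is at most 3/2. -/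
/-- The 4-path with `V = {a,b,c,d}` (encoded as `0,1,2,3 : Fin 4`) and
`E = {{a,b},{b,c},{c,d}}`: for every edge-dominated `E`-polymatroid `h`,
if `h(b) ≥ 1/2` then `h(abc) ≤ 3/2`; if `h(b) ≤ 1/2` then `h(bcd) ≤ 3/2`; hence
`min(max(h(abc), h(cd)), max(h(ab), h(bcd))) ≤ 3/2`, showing the relaxed `#smfw`
of the 4-path query with one additive inequality is at most `3/2`. -/
theorem four_path_relaxed_sharp_submodular_width_bound
    (h : Finset (Fin 4) → ℝ)
    (hEP : IsEPolymatroid ({({0, 1} : Finset (Fin 4)), {1, 2}, {2, 3}} : Finset (Finset (Fin 4))) h)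
    (hED : EdgeDominated ({({0, 1} : Finset (Fin 4)), {1, 2}, {2, 3}} : Finset (Finset (Fin 4))) h) :
    ((1 / 2 : ℝ) ≤ h {1} → h {0, 1, 2} ≤ 3 / 2) ∧
    (h {1} ≤ (1 / 2 : ℝ) → h {1, 2, 3} ≤ 3 / 2) ∧
    min (max (h {0, 1, 2}) (h {2, 3})) (max (h {0, 1}) (h {1, 2, 3})) ≤ (3 / 2 : ℝ) := by
  obtain ⟨-, h_empty, -, h_submod⟩ := hEP
  have h_ab : h {0, 1} ≤ 1 := hED _ (by simp)
  have h_bc : h {1, 2} ≤ 1 := hED _ (by simp)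
  have h_cd : h {2, 3} ≤ 1 := hED _ (by simp)
  have h_abc : h {0, 1, 2} + h {1} ≤ h {0, 1} + h {1, 2} :=
    h_submod {0, 1} {1, 2} ⟨{0, 1}, by simp, by decide⟩
  have h_bcd : h {1, 2, 3} + h ∅ ≤ h {1} + h {2, 3} :=
    h_submod {1} {2, 3} ⟨{0, 1}, by simp, by decide⟩
  refine ⟨fun hb => by linarith, fun hb => by linarith, ?_⟩
  rcases le_total (1 / 2 : ℝ) (h {1}) with hb | hb
  · exact min_le_of_left_le (max_le (by linarith) (by linarith))
  · exact min_le_of_right_le (max_le (by linarith) (by linarith))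
end
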